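/- arXiv:1709.02485 — 2 statements merged into one kernel-verified Lean document; each statement's English description precedes it below -/
import Mathlib

section
/- Let k ⊆ l be number fields with e = [l : k], let ω₁, …, ω_e be a k-basis of l contained in O_l, and let 𝔐 = {ω₁ν₁ + ⋯ + ω_eν_e : νᵢ ∈ O_k} ⊆ O_l be the full O_k-module they generate. Let O_𝔐 = {α ∈ l : α𝔐 ⊆ 𝔐}, O_𝔐^× = O_𝔐 ∩ O_l^×, and let E_{l/k}(𝔐) = {α ∈ O_𝔐^× : Norm_{l/k}(α) ∈ Tor(O_k^×)} be the group of relative units. Assume the rank r(l/k) of E_{l/k}(𝔐) is positive, and let ε₁, …, ε_{r(l/k)} be multiplicatively independent elements of E_{l/k}(𝔐). If β ≠ 0 is a point in O_k and μ ≠ 0 is a point in 𝔐 such that Norm_{l/k}(μ) = ζβ for some root of unity ζ ∈ Tor(O_k^×), then there exists γ in E_{l/k}(𝔐) such that γμ belongs to 𝔐, Norm_{l/k}(γμ) = ζ′β for some root of unity ζ′ ∈ Tor(O_k^×), and h(γμ) ≤ (1/2)·∑_{j=1}^{r(l/k)} h(ε_j) + [l : k]^{-1}·h(β). -/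
open NumberField Module

/-- The normalized logarithmic absolute value `log |x|_w` at an infinite place `w`
of a number field `F`, where `|·|_w = ‖·‖_w^{d_w/d}`. -/
noncomputable def infLogAbs (F : Type*) [Field F] [NumberField F]
    (w : InfinitePlace F) (x : F) : ℝ :=
  (w.mult : ℝ) / (finrank ℚ F : ℝ) * Real.log (w x)

/-- The normalized logarithmic absolute value `log |x|_v` at a finite place `v`
of a number field `F`. -/
noncomputable def finLogAbs (F : Type*) [Field F] [NumberField F]
    (v : IsDedekindDomain.HeightOneSpectrum (𝓞 F)) (x : F) : ℝ :=
  if h : (v.valuation (K := F)) x = 0 then 0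
  else ((Multiplicative.toAdd (WithZero.unzero h) : ℤ) : ℝ) / (finrank ℚ F : ℝ) *
    Real.log (Ideal.absNorm v.asIdeal)

/-- The absolute logarithmic Weil height `h(x) = ∑_w log⁺ |x|_w`, the sum running over
all (infinite and finite) places of the number field `F`. -/
noncomputable def weilHeight (F : Type*) [Field F] [NumberField F] (x : F) : ℝ :=
  (∑ w : InfinitePlace F, max 0 (infLogAbs F w x)) +
    ∑ᶠ v : IsDedekindDomain.HeightOneSpectrum (𝓞 F), max 0 (finLogAbs F v x)

/-- The full `O_k`-module `𝔐` generated by elements `ω i` of `l`. -/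
def fullModule (K : Type*) [Field K] [NumberField K] {L : Type*} [Field L]
    [Algebra K L] {e : ℕ} (ω : Fin e → L) : Set L :=
  {x | ∃ ν : Fin e → 𝓞 K, x = ∑ i, algebraMap K L (ν i : K) * ω i}

/-- The coefficient ring `O_𝔐 = {α ∈ l : α𝔐 ⊆ 𝔐}` of a full module `𝔐 ⊆ l`. -/
def coeffRing {L : Type*} [Field L] (M : Set L) : Set L :=
  {α | ∀ x ∈ M, α * x ∈ M}

/-- The unit group `O_𝔐^× = O_𝔐 ∩ O_l^×` of the coefficient ring. -/
def coeffRingUnits {L : Type*} [Field L] [NumberField L] (M : Set L) : Set L :=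
  {α | α ∈ coeffRing M ∧ ∃ u : (𝓞 L)ˣ, ((u : 𝓞 L) : L) = α}

/-- The group `E_{l/k}(𝔐) = {α ∈ O_𝔐^× : Norm_{l/k}(α) ∈ Tor(O_k^×)}` of relative units. -/
def relUnits (K : Type*) [Field K] [NumberField K] (L : Type*) [Field L] [NumberField L]
    [Algebra K L] (M : Set L) : Set L :=
  {α | α ∈ coeffRingUnits M ∧ ∃ n : ℕ, 0 < n ∧ (Algebra.norm K α) ^ n = 1}

/-- A family of elements of `Lˣ` is multiplicatively independent if no nontrivial
integer-power product of them equals `1`. -/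
def MulIndep {L : Type*} [Field L] {r : ℕ} (ε : Fin r → L) : Prop :=
  ∀ m : Fin r → ℤ, (∏ j, ε j ^ m j) = 1 → m = 0

open scoped Classical in
/-- The set of infinite places of `L` lying above an infinite place `v` of `K`. -/
noncomputable def placesAbove (K : Type*) [Field K] (L : Type*) [Field L] [NumberField L]
    [Algebra K L] (v : InfinitePlace K) : Finset (InfinitePlace L) :=
  Finset.univ.filter (fun w => w.comap (algebraMap K L) = v)

section PlaceLog

variable {L : Type*} [Field L]

/-- The vector of logarithms of the unnormalized absolute values at the infinite places. -/
noncomputable def placeLog (x : L) : InfinitePlace L → ℝ := fun w => Real.log (w x)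

theorem placeLog_one : placeLog (1 : L) = 0 := by
  ext w
  simp [placeLog]

theorem placeLog_mul {x y : L} (hx : x ≠ 0) (hy : y ≠ 0) :
    placeLog (x * y) = placeLog x + placeLog y := by
  ext w
  simp [placeLog, Real.log_mul, hx, hy]

theorem placeLog_pow (x : L) (n : ℕ) : placeLog (x ^ n) = (n : ℝ) • placeLog x := by
  ext w
  simp [placeLog]

theorem placeLog_zpow (x : L) (n : ℤ) : placeLog (x ^ n) = (n : ℝ) • placeLog x := by
  ext w
  simp [placeLog]

theorem placeLog_prod {ι : Type*} (s : Finset ι) (x : ι → L) (hx : ∀ i ∈ s, x i ≠ 0) :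
    placeLog (∏ i ∈ s, x i) = ∑ i ∈ s, placeLog (x i) := by
  ext w
  simp only [placeLog, map_prod, Finset.sum_apply]
  exact Real.log_prod fun i hi => (map_ne_zero w).2 (hx i hi)

theorem NumberField.InfinitePlace.apply_eq_one_of_pow_eq_one (w : InfinitePlace L) {x : L} {n : ℕ}
    (hn : 0 < n) (hx : x ^ n = 1) : w x = 1 := by
  have h := congrArg w hx
  rw [map_pow, map_one] at h
  exact (pow_eq_one_iff_of_nonneg (apply_nonneg w x) hn.ne').1 h

/-- A real vector orthogonal to the multiplicities lies in the real span of the logarithms of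
units. -/
theorem mem_span_placeLog_units [NumberField L] {z : InfinitePlace L → ℝ}
    (hz : ∑ w, (w.mult : ℝ) * z w = 0) :
    z ∈ Submodule.span ℝ (Set.range fun u : (𝓞 L)ˣ => placeLog (u : L)) := by
  classical
  set S := Submodule.span ℝ (Set.range fun u : (𝓞 L)ˣ => placeLog (u : L)) with hS
  let Ψ : (InfinitePlace L → ℝ) →ₗ[ℝ] Units.dirichletUnitTheorem.logSpace L :=
    { toFun := fun f w => (w.1.mult : ℝ) * f w.1
      map_add' := fun f g => by ext w; simp [mul_add]
      map_smul' := fun c f => by ext w; simp; ring }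
  have htop : S.map Ψ = ⊤ := by
    rw [hS, Submodule.map_span, ← Units.dirichletUnitTheorem.unitLattice_span_eq_top L]
    congr 1
    ext y
    constructor
    · rintro ⟨_, ⟨u, rfl⟩, rfl⟩
      exact ⟨Additive.ofMul u, trivial, rfl⟩
    · rintro ⟨u, -, rfl⟩
      exact ⟨_, ⟨u.toMul, rfl⟩, rfl⟩
  have hsum : ∀ s ∈ S, ∑ w : InfinitePlace L, (w.mult : ℝ) * s w = 0 := by
    intro s hs
    induction hs using Submodule.span_induction with
    | mem x hx => obtain ⟨u, rfl⟩ := hx; exact Units.sum_mult_mul_log u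
    | zero => simp
    | add x y _ _ hx hy =>
      simp only [Pi.add_apply, mul_add, Finset.sum_add_distrib, hx, hy, add_zero]
    | smul c x _ hx =>
      simp only [Pi.smul_apply, smul_eq_mul, mul_left_comm _ c, ← Finset.mul_sum, hx, mul_zero]
  obtain ⟨s, hs, hsz⟩ : Ψ z ∈ S.map Ψ := htop ▸ trivial
  have hoff : ∀ w, w ≠ Units.dirichletUnitTheorem.w₀ → s w = z w := fun w hw =>
    mul_left_cancel₀ InfinitePlace.mult_coe_ne_zero (congrFun hsz ⟨w, hw⟩)
  suffices s = z from this ▸ hs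
  ext w
  by_cases hw : w = Units.dirichletUnitTheorem.w₀
  · subst hw
    have h := (hsum s hs).trans hz.symm
    rw [Fintype.sum_eq_add_sum_subtype_ne _ Units.dirichletUnitTheorem.w₀,
      Fintype.sum_eq_add_sum_subtype_ne (fun w => (w.mult : ℝ) * z w)
        Units.dirichletUnitTheorem.w₀] at h
    simp only [fun v : {w : InfinitePlace L // w ≠ Units.dirichletUnitTheorem.w₀} =>
      hoff v.1 v.2] at h
    exact mul_left_cancel₀ InfinitePlace.mult_coe_ne_zero (add_right_cancel h)
  · exact hoff w hw

theorem sum_mult_mul_placeLog [NumberField L] {x : L} (hx : x ≠ 0) :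
    ∑ w : InfinitePlace L, (w.mult : ℝ) * placeLog x w = Real.log |(Algebra.norm ℚ x : ℝ)| := by
  have h := congrArg Real.log (InfinitePlace.prod_eq_abs_norm x)
  rw [Real.log_prod fun w _ => pow_ne_zero _ ((map_ne_zero w).2 hx)] at h
  simpa [placeLog, Real.log_pow] using h

end PlaceLog

section RelativeNorm

variable {K L : Type*} [Field K] [NumberField K] [Field L] [NumberField L] [Algebra K L]

open scoped Classical in
theorem sum_filter_comp_algebraMap_eq {R : Type*} [AddCommMonoid R] (φ : K →+* ℂ)
    (g : (L →+* ℂ) → R) :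
    letI := φ.toAlgebra
    ∑ σ : L →+* ℂ with σ.comp (algebraMap K L) = φ, g σ = ∑ τ : L →ₐ[K] ℂ, g τ.toRingHom := by
  let := φ.toAlgebra
  symm
  refine Finset.sum_bij (fun τ _ => τ.toRingHom) ?_ ?_ ?_ ?_
  · intro τ _
    simp only [Finset.mem_filter, Finset.mem_univ, true_and]
    exact τ.comp_algebraMap
  · intro τ _ τ' _ h
    exact AlgHom.coe_ringHom_injective h
  · intro σ hσ
    simp only [Finset.mem_filter, Finset.mem_univ, true_and] at hσ
    exact ⟨{ σ with commutes' := fun x => RingHom.congr_fun hσ x }, Finset.mem_univ _, rfl⟩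
  · intro τ _
    rfl

open scoped Classical in
theorem card_filter_comp_algebraMap_eq (φ : K →+* ℂ) :
    (Finset.univ.filter fun σ : L →+* ℂ => σ.comp (algebraMap K L) = φ).card = finrank K L := by
  let := φ.toAlgebra
  rw [← AlgHom.card K L ℂ, Finset.card_eq_sum_ones, sum_filter_comp_algebraMap_eq φ fun _ => 1]
  simp

open scoped Classical in
/-- The relative norm formula at an embedding `φ` of the base field. -/
theorem sum_filter_placeLog (φ : K →+* ℂ) {x : L} (hx : x ≠ 0) :
    ∑ σ : L →+* ℂ with σ.comp (algebraMap K L) = φ, placeLog x (InfinitePlace.mk σ) =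
      placeLog (Algebra.norm K x) (InfinitePlace.mk φ) := by
  let := φ.toAlgebra
  rw [sum_filter_comp_algebraMap_eq φ fun σ => placeLog x (InfinitePlace.mk σ)]
  have h : φ (Algebra.norm K x) = ∏ τ : L →ₐ[K] ℂ, τ x := Algebra.norm_eq_prod_embeddings K ℂ x
  simp only [placeLog, InfinitePlace.apply, h, norm_prod]
  rw [Real.log_prod fun τ _ => norm_ne_zero_iff.2 ((map_ne_zero τ).2 hx)]
  rfl

open scoped Classical in
theorem sum_mult_mul_eq_sum_embeddings (f : InfinitePlace L → ℝ) :
    ∑ w, (w.mult : ℝ) * f w = ∑ σ : L →+* ℂ, f (InfinitePlace.mk σ) := by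
  rw [← Finset.sum_fiberwise (s := Finset.univ) (g := InfinitePlace.mk (K := L))]
  refine Finset.sum_congr rfl fun w _ => ?_
  rw [← InfinitePlace.card_filter_mk_eq w, ← nsmul_eq_mul, ← Finset.sum_const]
  refine Finset.sum_congr (by congr!) fun σ hσ => ?_
  rw [(Finset.mem_filter.1 hσ).2]

theorem sum_mult_mul_comap (f : InfinitePlace K → ℝ) :
    ∑ w : InfinitePlace L, (w.mult : ℝ) * f (w.comap (algebraMap K L)) =
      finrank K L * ∑ v : InfinitePlace K, (v.mult : ℝ) * f v := by
  classical
  rw [sum_mult_mul_eq_sum_embeddings fun w => f (w.comap (algebraMap K L)),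
    sum_mult_mul_eq_sum_embeddings f, Finset.mul_sum,
    ← Finset.sum_fiberwise (s := Finset.univ) (g := fun σ : L →+* ℂ => σ.comp (algebraMap K L))]
  refine Finset.sum_congr rfl fun φ _ => ?_
  rw [← card_filter_comp_algebraMap_eq (L := L) φ, ← nsmul_eq_mul, ← Finset.sum_const]
  refine Finset.sum_congr (by congr!) fun σ hσ => ?_
  rw [InfinitePlace.comap_mk, (Finset.mem_filter.1 hσ).2]

variable (K) in
/-- The logarithmic vector of `x`, recentred at the places above each infinite place of `K`. -/
noncomputable def relPlaceLog (x : L) : InfinitePlace L → ℝ :=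
  fun w => placeLog x w -
    (finrank K L : ℝ)⁻¹ * placeLog (Algebra.norm K x) (w.comap (algebraMap K L))

open scoped Classical in
variable (K L) in
/-- The linear projection subtracting from a vector its means over the places above each
infinite place of `K`. -/
noncomputable def relProj : (InfinitePlace L → ℝ) →ₗ[ℝ] (InfinitePlace L → ℝ) where
  toFun f w := f w - (finrank K L : ℝ)⁻¹ * ∑ σ : L →+* ℂ
    with σ.comp (algebraMap K L) = (w.comap (algebraMap K L)).embedding, f (InfinitePlace.mk σ)
  map_add' f g := by
    ext w
    simp only [Pi.add_apply, Finset.sum_add_distrib]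
    ring
  map_smul' c f := by
    ext w
    simp only [Pi.smul_apply, smul_eq_mul, ← Finset.mul_sum, RingHom.id_apply]
    ring

theorem relProj_placeLog {x : L} (hx : x ≠ 0) : relProj K L (placeLog x) = relPlaceLog K x := by
  ext w
  simp only [relProj, LinearMap.coe_mk, AddHom.coe_mk, relPlaceLog]
  rw [sum_filter_placeLog _ hx, InfinitePlace.mk_embedding]

theorem relProj_relPlaceLog {x : L} (hx : x ≠ 0) :
    relProj K L (relPlaceLog K x) = relPlaceLog K x := by
  classical
  have he : (finrank K L : ℝ) ≠ 0 := Nat.cast_ne_zero.2 finrank_pos.ne'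
  ext w
  simp only [relProj, LinearMap.coe_mk, AddHom.coe_mk, sub_eq_self, mul_eq_zero]
  right
  simp only [relPlaceLog, Finset.sum_sub_distrib, InfinitePlace.comap_mk]
  rw [sum_filter_placeLog _ hx, Finset.sum_congr rfl fun σ hσ => by
    rw [(Finset.mem_filter.1 hσ).2], Finset.sum_const, card_filter_comp_algebraMap_eq,
    nsmul_eq_mul, mul_inv_cancel_left₀ he, sub_self]

theorem sum_mult_mul_relPlaceLog {x : L} (hx : x ≠ 0) :
    ∑ w : InfinitePlace L, (w.mult : ℝ) * relPlaceLog K x w = 0 := by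
  have he : (finrank K L : ℝ) ≠ 0 := Nat.cast_ne_zero.2 finrank_pos.ne'
  simp only [relPlaceLog, mul_sub, Finset.sum_sub_distrib, mul_left_comm _ (finrank K L : ℝ)⁻¹,
    ← Finset.mul_sum]
  rw [sum_mult_mul_comap, inv_mul_cancel_left₀ he, sum_mult_mul_placeLog hx,
    sum_mult_mul_placeLog (Algebra.norm_ne_zero_iff.2 hx), Algebra.norm_norm, sub_self]

/-- The recentred logarithmic vectors of units span those of all nonzero elements. -/
theorem relPlaceLog_mem_span {x : L} (hx : x ≠ 0) :
    relPlaceLog K x ∈ Submodule.span ℝ (Set.range fun u : (𝓞 L)ˣ => relPlaceLog K (u : L)) := by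
  have h := Submodule.mem_map_of_mem (f := relProj K L)
    (mem_span_placeLog_units (sum_mult_mul_relPlaceLog (K := K) hx))
  rw [relProj_relPlaceLog hx, Submodule.map_span, ← Set.range_comp] at h
  convert h using 4 with u
  exact (relProj_placeLog (Units.coe_ne_zero u)).symm

/-- `u ^ [L : K] / N(u)` is a unit of relative norm one whose logarithmic vector is a multiple
of that of `u`. -/
theorem exists_unit_norm_eq_one (u : (𝓞 L)ˣ) :
    ∃ v : (𝓞 L)ˣ, Algebra.norm K (v : L) = 1 ∧
      placeLog (v : L) = (finrank K L : ℝ) • relPlaceLog K (u : L) := by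
  have he : (finrank K L : ℝ) ≠ 0 := Nat.cast_ne_zero.2 finrank_pos.ne'
  let n : (𝓞 K)ˣ := Units.map (RingOfIntegers.norm K) u
  have hn : ((n : 𝓞 K) : K) = Algebra.norm K (u : L) := rfl
  have hn0 : Algebra.norm K (u : L) ≠ 0 := Algebra.norm_ne_zero_iff.2 (Units.coe_ne_zero u)
  let v : (𝓞 L)ˣ := u ^ finrank K L * (Units.map (algebraMap (𝓞 K) (𝓞 L)).toMonoidHom n)⁻¹
  have hv : (v : L) = (u : L) ^ finrank K L * (algebraMap K L (Algebra.norm K (u : L)))⁻¹ := by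
    rw [eq_mul_inv_iff_mul_eq₀ (by simp), ← Units.coe_pow]
    exact congrArg (fun y : (𝓞 L)ˣ => (y : L)) (inv_mul_cancel_right (u ^ finrank K L) _)
  refine ⟨v, ?_, ?_⟩
  · rw [hv, map_mul, map_pow, ← map_inv₀, Algebra.norm_algebraMap, ← mul_pow,
      mul_inv_cancel₀ hn0, one_pow]
  · ext w
    simp only [placeLog, hv, relPlaceLog, Pi.smul_apply, smul_eq_mul, map_mul, map_pow, map_inv₀]
    rw [Real.log_mul, Real.log_pow, Real.log_inv, mul_sub, mul_inv_cancel_left₀ he,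
      InfinitePlace.comap_apply]
    · ring
    · simp
    · simp

end RelativeNorm

section CoefficientRing

variable {L : Type*} [Field L] {M : Set L}

theorem one_mem_coeffRing : (1 : L) ∈ coeffRing M := fun x hx => by rwa [one_mul]

theorem mul_mem_coeffRing {x y : L} (hx : x ∈ coeffRing M) (hy : y ∈ coeffRing M) :
    x * y ∈ coeffRing M := fun z hz => by
  rw [mul_assoc]
  exact hx _ (hy _ hz)

theorem pow_mem_coeffRing {x : L} (hx : x ∈ coeffRing M) (n : ℕ) : x ^ n ∈ coeffRing M := by
  induction n with
  | zero => rw [pow_zero]; exact one_mem_coeffRing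
  | succ n ih => rw [pow_succ]; exact mul_mem_coeffRing ih hx

variable {K : Type*} [Field K] [NumberField K] [Algebra K L]

theorem fullModule_eq_span {e : ℕ} (ω : Fin e → L) :
    fullModule K ω = Submodule.span (𝓞 K) (Set.range ω) := by
  ext x
  rw [SetLike.mem_coe, Submodule.mem_span_range_iff_exists_fun]
  simp only [fullModule, Set.mem_ofPred_eq, Algebra.smul_def, eq_comm (a := x)]
  rfl

variable [NumberField L]

/-- Some nonzero integer of the base field multiplies all of `𝓞 L` into the coefficient ring. -/
theorem exists_algebraMap_mul_mem_coeffRing {e : ℕ} (b : Basis (Fin e) K L) :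
    ∃ D : 𝓞 K, D ≠ 0 ∧ ∀ x : 𝓞 L,
      algebraMap (𝓞 K) L D * (x : L) ∈ coeffRing (fullModule K fun i => b i) := by
  let a := RingOfIntegers.basis L
  obtain ⟨D, hD⟩ := IsLocalization.exist_integer_multiples_of_finite (nonZeroDivisors (𝓞 K))
    fun p : (Free.ChooseBasisIndex ℤ (𝓞 L) × Fin e) × Fin e =>
      b.repr ((a p.1.1 : L) * b p.1.2) p.2
  refine ⟨D, nonZeroDivisors.coe_ne_zero D, fun x m hm => ?_⟩
  rw [fullModule_eq_span] at hm ⊢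
  rw [SetLike.mem_coe] at hm ⊢
  have hbasis : ∀ i j, algebraMap (𝓞 K) L D * ((a i : L) * b j) ∈
      Submodule.span (𝓞 K) (Set.range fun i => b i) := by
    intro i j
    rw [← b.sum_repr ((a i : L) * b j), Finset.mul_sum]
    refine Submodule.sum_mem _ fun k _ => ?_
    obtain ⟨c, hc⟩ := hD ((i, j), k)
    have : algebraMap (𝓞 K) L D * (b.repr ((a i : L) * b j) k • b k) = c • b k := by
      rw [← Algebra.smul_def, ← smul_assoc, ← hc, algebraMap_smul]
    rw [this]
    exact Submodule.smul_mem _ _ (Submodule.subset_span ⟨k, rfl⟩)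
  have hgen : ∀ i, algebraMap (𝓞 K) L D * ((a i : L) * m) ∈
      Submodule.span (𝓞 K) (Set.range fun i => b i) := by
    intro i
    induction hm using Submodule.span_induction with
    | mem y hy => obtain ⟨j, rfl⟩ := hy; exact hbasis i j
    | zero => simp
    | add y z _ _ hy hz => rw [mul_add, mul_add]; exact Submodule.add_mem _ hy hz
    | smul c y _ hy => rw [mul_smul_comm, mul_smul_comm]; exact Submodule.smul_mem _ c hy
  rw [mul_assoc, ← a.sum_repr x]
  simp only [map_sum, Finset.sum_mul, Finset.mul_sum]
  refine Submodule.sum_mem _ fun i _ => ?_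
  rw [map_zsmul, smul_mul_assoc, mul_smul_comm]
  exact zsmul_mem (hgen i) _

theorem exists_pow_mem_coeffRing {e : ℕ} (b : Basis (Fin e) K L) (u : (𝓞 L)ˣ) :
    ∃ n : ℕ, 0 < n ∧ (u : L) ^ n ∈ coeffRing (fullModule K fun i => b i) := by
  obtain ⟨D, hD, hDM⟩ := exists_algebraMap_mul_mem_coeffRing b
  let I : Ideal (𝓞 L) := Ideal.span {algebraMap (𝓞 K) (𝓞 L) D}
  have hI : I ≠ ⊥ := by
    rw [Ne, Ideal.span_singleton_eq_bot]
    exact (map_ne_zero_iff _ (FaithfulSMul.algebraMap_injective (𝓞 K) (𝓞 L))).2 hD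
  have : Finite (𝓞 L ⧸ I) := Ideal.finiteQuotientOfFreeOfNeBot I hI
  obtain ⟨n, hn, hun⟩ := (isOfFinOrder_of_finite
    (Units.map (Ideal.Quotient.mk I).toMonoidHom u)).exists_pow_eq_one
  refine ⟨n, hn, ?_⟩
  have hmem : (u : 𝓞 L) ^ n - 1 ∈ I := by
    rw [← Ideal.Quotient.mk_eq_mk_iff_sub_mem, map_pow, map_one]
    exact congrArg Units.val hun
  obtain ⟨y, hy⟩ := Ideal.mem_span_singleton.1 hmem
  have hu : (u : L) ^ n = 1 + algebraMap (𝓞 K) L D * (y : L) := by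
    have h := congrArg (algebraMap (𝓞 L) L) hy
    rw [map_sub, map_pow, map_one, map_mul, ← IsScalarTower.algebraMap_apply] at h
    exact sub_eq_iff_eq_add'.1 h
  intro m hm
  have h := hDM y m hm
  rw [hu, add_mul, one_mul]
  rw [fullModule_eq_span] at hm h ⊢
  exact Submodule.add_mem _ hm h

theorem ne_zero_of_mem_relUnits {x : L} (hx : x ∈ relUnits K L M) : x ≠ 0 := by
  obtain ⟨⟨-, u, rfl⟩, -⟩ := hx
  exact NumberField.Units.coe_ne_zero u

/-- The relative units as a subgroup of `Lˣ`. -/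
def relUnitsSubgroup {e : ℕ} (b : Basis (Fin e) K L) : Subgroup Lˣ where
  carrier := {x | (x : L) ∈ relUnits K L (fullModule K fun i => b i)}
  one_mem' := ⟨⟨one_mem_coeffRing, 1, rfl⟩, 1, one_pos, by simp⟩
  mul_mem' := by
    rintro x y ⟨⟨hx, u, hu⟩, m, hm, hxm⟩ ⟨⟨hy, v, hv⟩, n, hn, hyn⟩
    refine ⟨⟨mul_mem_coeffRing hx hy, u * v, by simp [hu, hv]⟩, m * n, Nat.mul_pos hm hn, ?_⟩
    rw [Units.val_mul, map_mul, mul_pow, pow_mul, hxm, one_pow, mul_comm m, pow_mul, hyn, one_pow,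
      one_mul]
  inv_mem' := by
    rintro x ⟨⟨hx, u, hu⟩, m, hm, hxm⟩
    have hinv : ((u⁻¹ : (𝓞 L)ˣ) : L) = (x : L)⁻¹ := by
      have h := NumberField.Units.coe_zpow u (-1)
      simp only [zpow_neg, zpow_one] at h
      rw [h]
      exact congrArg _ hu
    obtain ⟨n, hn, hpow⟩ := exists_pow_mem_coeffRing b u⁻¹
    refine ⟨⟨?_, u⁻¹, by simpa using hinv⟩, m, hm, ?_⟩
    · obtain ⟨n, rfl⟩ := Nat.exists_eq_succ_of_ne_zero hn.ne'
      have h := mul_mem_coeffRing hpow (pow_mem_coeffRing hx n)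
      rwa [hinv, pow_succ', mul_assoc, ← mul_pow, inv_mul_cancel₀ x.ne_zero, one_pow, mul_one,
        ← Units.val_inv_eq_inv_val] at h
    · rw [map_units_inv, inv_pow, hxm, inv_one]

end CoefficientRing

section Height

variable {F : Type*} [Field F] [NumberField F]

theorem infLogAbs_eq_placeLog (w : InfinitePlace F) (x : F) :
    infLogAbs F w x = (w.mult : ℝ) / finrank ℚ F * placeLog x w := rfl

theorem finLogAbs_nonpos (v : IsDedekindDomain.HeightOneSpectrum (𝓞 F)) {x : F}
    (hx : IsIntegral ℤ x) : finLogAbs F v x ≤ 0 := by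
  rw [finLogAbs]
  split_ifs with h
  · rfl
  · refine mul_nonpos_of_nonpos_of_nonneg (div_nonpos_of_nonpos_of_nonneg ?_ (Nat.cast_nonneg _))
      (Real.log_natCast_nonneg _)
    have h1 : v.valuation F x ≤ 1 := v.valuation_le_one (⟨x, hx⟩ : 𝓞 F)
    have h2 : WithZero.unzero h ≤ 1 := by
      rwa [← WithZero.coe_le_coe, WithZero.coe_unzero]
    exact_mod_cast h2

theorem weilHeight_of_isIntegral {x : F} (hx : IsIntegral ℤ x) :
    weilHeight F x = ∑ w : InfinitePlace F, max 0 (infLogAbs F w x) := by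
  simp [weilHeight, fun v => max_eq_left (finLogAbs_nonpos v hx)]

theorem sum_max_infLogAbs_unit_le (u : (𝓞 F)ˣ) (s : ℝ) (hs : |s| ≤ 1 / 2) :
    ∑ w : InfinitePlace F, max 0 (s * infLogAbs F w (u : F)) ≤ 1 / 2 * weilHeight F (u : F) := by
  have h0 : ∑ w : InfinitePlace F, infLogAbs F w (u : F) = 0 := by
    have h := Units.sum_mult_mul_log u
    simp only [infLogAbs, div_mul_eq_mul_div, ← Finset.sum_div, h, zero_div]
  have habs : ∀ t : ℝ, max 0 t = (t + |t|) / 2 := fun t => by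
    rcases le_total 0 t with ht | ht
    · rw [max_eq_right ht, abs_of_nonneg ht]; ring
    · rw [max_eq_left ht, abs_of_nonpos ht]; ring
  rw [weilHeight_of_isIntegral (RingOfIntegers.isIntegral_coe (u : 𝓞 F))]
  simp only [habs, abs_mul, ← Finset.sum_div, Finset.sum_add_distrib, ← Finset.mul_sum, h0,
    mul_zero, zero_add]
  have := Finset.sum_nonneg fun (w : InfinitePlace F) (_ : w ∈ Finset.univ) =>
    abs_nonneg (infLogAbs F w (u : F))
  nlinarith

theorem max_zero_add_sum_le {ι : Type*} (s : Finset ι) (a : ℝ) (f : ι → ℝ) :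
    max 0 (a + ∑ i ∈ s, f i) ≤ max 0 a + ∑ i ∈ s, max 0 (f i) :=
  max_le (add_nonneg (le_max_left _ _) (Finset.sum_nonneg fun _ _ => le_max_left _ _))
    (add_le_add (le_max_right _ _) (Finset.sum_le_sum fun _ _ => le_max_right _ _))

variable {K L : Type*} [Field K] [NumberField K] [Field L] [NumberField L] [Algebra K L]

theorem sum_max_comap (x : K) (hx : IsIntegral ℤ x) :
    ∑ w : InfinitePlace L, max 0 ((w.mult : ℝ) / finrank ℚ L *
      ((finrank K L : ℝ)⁻¹ * placeLog x (w.comap (algebraMap K L)))) =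
      (finrank K L : ℝ)⁻¹ * weilHeight K x := by
  have he : (finrank K L : ℝ) ≠ 0 := Nat.cast_ne_zero.2 finrank_pos.ne'
  have hd : (finrank ℚ K : ℝ) ≠ 0 := Nat.cast_ne_zero.2 finrank_pos.ne'
  have hmul : (finrank ℚ L : ℝ) = finrank ℚ K * finrank K L := by
    rw [← finrank_mul_finrank ℚ K L, Nat.cast_mul]
  have hmax : ∀ {a : ℝ} (t : ℝ), 0 ≤ a → max 0 (a * t) = a * max 0 t := fun t ha => by
    rw [mul_max_of_nonneg _ _ ha, mul_zero]
  have hL : ∀ w : InfinitePlace L, max 0 ((w.mult : ℝ) / finrank ℚ L *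
      ((finrank K L : ℝ)⁻¹ * placeLog x (w.comap (algebraMap K L)))) =
      ((finrank ℚ L : ℝ)⁻¹ * (finrank K L : ℝ)⁻¹) *
        ((w.mult : ℝ) * max 0 (placeLog x (w.comap (algebraMap K L)))) := fun w => by
    rw [hmax _ (by positivity), hmax _ (by positivity)]
    ring
  have hK : ∀ v : InfinitePlace K, max 0 (infLogAbs K v x) =
      (finrank ℚ K : ℝ)⁻¹ * ((v.mult : ℝ) * max 0 (placeLog x v)) := fun v => by
    rw [infLogAbs_eq_placeLog, hmax _ (by positivity)]
    ring
  rw [weilHeight_of_isIntegral hx]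
  simp only [hL, hK, ← Finset.mul_sum]
  rw [sum_mult_mul_comap fun v => max 0 (placeLog x v), hmul]
  field_simp

end Height

section Rank

variable {K L : Type*} [Field K] [NumberField K] [Field L] [NumberField L] [Algebra K L]

/-- A maximal multiplicatively independent family of relative units spans all recentred
logarithmic vectors. -/
theorem relPlaceLog_mem_span_of_maximal {e r : ℕ} (b : Basis (Fin e) K L) {ε : Fin r → L}
    (hε : ∀ j, ε j ∈ relUnits K L (fullModule K fun i => b i)) (hind : MulIndep ε)
    (hrank : ∀ η : Fin (r + 1) → L, (∀ i, η i ∈ relUnits K L (fullModule K fun i => b i)) →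
      ¬ MulIndep η) {x : L} (hx : x ≠ 0) :
    relPlaceLog K x ∈ Submodule.span ℝ (Set.range fun j => placeLog (ε j)) := by
  refine Submodule.span_le.2 ?_ (relPlaceLog_mem_span hx)
  rintro _ ⟨u, rfl⟩
  obtain ⟨v, hv, hvu⟩ := exists_unit_norm_eq_one (K := K) u
  obtain ⟨n, hn, hvn⟩ := exists_pow_mem_coeffRing b v
  have hε0 : ∀ j, ε j ≠ 0 := fun j => ne_zero_of_mem_relUnits (hε j)
  have hη := hrank (Fin.cons ((v : L) ^ n) ε) fun i => by
    refine Fin.cases ?_ hε i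
    exact ⟨⟨hvn, v ^ n, by simp⟩, 1, one_pos, by simp [hv]⟩
  simp only [MulIndep, not_forall] at hη
  obtain ⟨m, hm, hm0⟩ := hη
  rw [Fin.prod_univ_succ] at hm
  simp only [Fin.cons_zero, Fin.cons_succ] at hm
  have hm1 : m 0 ≠ 0 := fun h => hm0 <| by
    rw [h, zpow_zero, one_mul] at hm
    have h' := hind _ hm
    ext i
    exact Fin.cases h (fun j => congrFun h' j) i
  have hlog := congrArg placeLog hm
  rw [placeLog_mul (zpow_ne_zero _ (pow_ne_zero _ (Units.coe_ne_zero v)))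
    (Finset.prod_ne_zero_iff.2 fun j _ => zpow_ne_zero _ (hε0 j)), placeLog_one,
    placeLog_prod _ _ fun j _ => zpow_ne_zero _ (hε0 j), placeLog_zpow, placeLog_pow, hvu,
    smul_smul, smul_smul] at hlog
  have hc : (m 0 : ℝ) * (n * finrank K L) ≠ 0 :=
    mul_ne_zero (Int.cast_ne_zero.2 hm1)
      (mul_ne_zero (Nat.cast_ne_zero.2 hn.ne') (Nat.cast_ne_zero.2 finrank_pos.ne'))
  rw [← mul_assoc] at hc
  rw [SetLike.mem_coe, ← Submodule.smul_mem_iff _ hc, eq_neg_of_add_eq_zero_left hlog]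
  refine Submodule.neg_mem _ (Submodule.sum_mem _ fun j _ => ?_)
  rw [placeLog_zpow]
  exact Submodule.smul_mem _ _ (Submodule.subset_span ⟨j, rfl⟩)

end Rank

/-- **Theorem 1.1.** Let `𝔐 ⊆ O_l` be the full `O_k`-module generated by a `k`-basis
`ω₁, …, ω_e` of `l` consisting of algebraic integers, and assume the rank `r` of the
group `E_{l/k}(𝔐)` of relative units is positive.  Let `ε₁, …, ε_r` be multiplicatively
independent units in `E_{l/k}(𝔐)`.  If `β ≠ 0` in `O_k` and `μ ≠ 0` in `𝔐` satisfy
`Norm_{l/k}(μ) = ζβ` with `ζ ∈ Tor(O_k^×)`, then there is `γ ∈ E_{l/k}(𝔐)` with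
`γμ ∈ 𝔐`, `Norm_{l/k}(γμ) = ζ'β` for some root of unity `ζ'`, and
`h(γμ) ≤ (1/2) ∑ⱼ h(εⱼ) + [l:k]⁻¹ h(β)`. -/
theorem height_of_solutions_of_norm_form_pos_rank
    (K L : Type*) [Field K] [NumberField K] [Field L] [NumberField L] [Algebra K L]
    (e : ℕ) (he : e = finrank K L) (b : Basis (Fin e) K L)
    (hbInt : ∀ i, IsIntegral ℤ (b i))
    (M : Set L) (hM : M = fullModule K (fun i => b i))
    -- `r` is the rank of the group `E_{l/k}(𝔐)` of relative units, and it is positive: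
    (r : ℕ) (hr : 0 < r)
    (hrank : ∀ η : Fin (r + 1) → L, (∀ i, η i ∈ relUnits K L M) → ¬ MulIndep η)
    -- multiplicatively independent relative units `ε₁, …, ε_r`:
    (ε : Fin r → L) (hε : ∀ j, ε j ∈ relUnits K L M) (hind : MulIndep ε)
    (β : K) (hβInt : IsIntegral ℤ β) (hβ : β ≠ 0)
    (μ : L) (hμM : μ ∈ M) (hμ : μ ≠ 0)
    (ζ : K) (hζ : ∃ n : ℕ, 0 < n ∧ ζ ^ n = 1)
    (hNorm : Algebra.norm K μ = ζ * β) :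
    ∃ γ ∈ relUnits K L M, γ * μ ∈ M ∧
      (∃ ζ' : K, (∃ n : ℕ, 0 < n ∧ ζ' ^ n = 1) ∧ Algebra.norm K (γ * μ) = ζ' * β) ∧
      weilHeight L (γ * μ) ≤
        (1 / 2) * ∑ j, weilHeight L (ε j) + (finrank K L : ℝ)⁻¹ * weilHeight K β := by
  subst hM
  have hε0 : ∀ j, ε j ≠ 0 := fun j => ne_zero_of_mem_relUnits (hε j)
  obtain ⟨t, ht⟩ := (Submodule.mem_span_range_iff_exists_fun ℝ).1
    (relPlaceLog_mem_span_of_maximal b hε hind hrank hμ)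
  let g : Lˣ := ∏ j, Units.mk0 (ε j) (hε0 j) ^ (-round (t j))
  have hg : (g : L) ∈ relUnits K L (fullModule K fun i => b i) :=
    (relUnitsSubgroup b).prod_mem fun j _ => (relUnitsSubgroup b).zpow_mem (hε j) _
  have hgval : (g : L) = ∏ j, ε j ^ (-round (t j)) := by simp [g]
  have hμint : IsIntegral ℤ μ := by
    obtain ⟨ν, rfl⟩ := hμM
    exact IsIntegral.sum _ fun i _ => ((RingOfIntegers.isIntegral_coe (ν i)).map
      ((algebraMap K L).toIntAlgHom)).mul (hbInt i)
  have hgM := hg.1.1 μ hμM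
  obtain ⟨⟨-, y, hy⟩, n, hn, hgn⟩ := id hg
  obtain ⟨k, hk, hζk⟩ := hζ
  refine ⟨g, hg, hgM, ⟨Algebra.norm K (g : L) * ζ, ⟨n * k, Nat.mul_pos hn hk, ?_⟩, ?_⟩, ?_⟩
  · rw [mul_pow, pow_mul, hgn, one_pow, mul_comm n, pow_mul, hζk, one_pow, one_mul]
  · rw [map_mul, hNorm, mul_assoc]
  have hβlog : placeLog (Algebra.norm K μ) = placeLog β := by
    ext v
    simp [placeLog, hNorm, InfinitePlace.apply_eq_one_of_pow_eq_one v hk hζk]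
  have hlog : ∀ w, infLogAbs L w (g * μ) = (w.mult : ℝ) / finrank ℚ L *
      ((finrank K L : ℝ)⁻¹ * placeLog β (w.comap (algebraMap K L))) +
      ∑ j, (t j - round (t j)) * infLogAbs L w (ε j) := by
    intro w
    have hμw : placeLog μ w = (finrank K L : ℝ)⁻¹ * placeLog β (w.comap (algebraMap K L)) +
        ∑ j, t j * placeLog (ε j) w := by
      have h := congrFun ht w
      simp only [relPlaceLog, hβlog, Finset.sum_apply, Pi.smul_apply, smul_eq_mul] at h
      linarith
    have hgw : placeLog (g : L) w = ∑ j, -(round (t j) : ℝ) * placeLog (ε j) w := by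
      rw [hgval, placeLog_prod _ _ fun j _ => zpow_ne_zero _ (hε0 j), Finset.sum_apply]
      simp only [placeLog_zpow, Pi.smul_apply, smul_eq_mul, Int.cast_neg]
    simp only [infLogAbs_eq_placeLog, placeLog_mul g.ne_zero hμ, Pi.add_apply, hμw, hgw]
    simp only [sub_mul, neg_mul, Finset.sum_sub_distrib, Finset.sum_neg_distrib, mul_add,
      mul_left_comm _ ((w.mult : ℝ) / finrank ℚ L), ← Finset.mul_sum]
    ring
  have hgint : IsIntegral ℤ (g : L) := by
    rw [← hy]
    exact RingOfIntegers.isIntegral_coe _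
  rw [weilHeight_of_isIntegral (hgint.mul hμint)]
  calc ∑ w, max 0 (infLogAbs L w (g * μ))
      ≤ ∑ w : InfinitePlace L, (max 0 ((w.mult : ℝ) / finrank ℚ L *
          ((finrank K L : ℝ)⁻¹ * placeLog β (w.comap (algebraMap K L)))) +
          ∑ j, max 0 ((t j - round (t j)) * infLogAbs L w (ε j))) :=
        Finset.sum_le_sum fun w _ => hlog w ▸ max_zero_add_sum_le _ _ _
    _ = (finrank K L : ℝ)⁻¹ * weilHeight K β +
          ∑ j, ∑ w, max 0 ((t j - round (t j)) * infLogAbs L w (ε j)) := by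
        rw [Finset.sum_add_distrib, sum_max_comap β hβInt, Finset.sum_comm]
    _ ≤ (finrank K L : ℝ)⁻¹ * weilHeight K β + ∑ j, 1 / 2 * weilHeight L (ε j) := by
        gcongr with j
        obtain ⟨⟨-, u, hu⟩, -⟩ := hε j
        rw [← hu]
        exact sum_max_infLogAbs_unit_le u _ (abs_sub_round _)
    _ = _ := by rw [← Finset.mul_sum, add_comm]
end

section
/- Let k ⊆ l be number fields, 𝔐 ⊆ O_l a full O_k-module generated by a k-basis of l, and E_{l/k}(𝔐) its group of relative units, of rank r(l/k) = r(l) − r(k). Let ε₁, …, ε_{r(l/k)} be multiplicatively independent elements of E_{l/k}(𝔐), and let 𝔈 be the subgroup they generate. Let z = (z_w) be a vector of real numbers indexed by the archimedean places w of l such that ∑_{w|v} z_w = 0 for every archimedean place v of k. Then there exists γ ∈ 𝔈 such that ∑_{w|∞} |log|γ|_w − z_w| ≤ ∑_{j=1}^{r(l/k)} h(ε_j), the outer sum being over all archimedean places w of l. -/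
open NumberField Module

open scoped Classical in
theorem sum_log_norm_embeddings_over (K L : Type*) [Field K] [NumberField K] [Field L]
    [NumberField L] [Algebra K L] (φ : K →+* ℂ) {x : L} (hx : x ≠ 0) :
    ∑ σ : L →+* ℂ with σ.comp (algebraMap K L) = φ, Real.log ‖σ x‖ =
      Real.log ‖φ (Algebra.norm K x)‖ := by
  let : Algebra K ℂ := φ.toAlgebra
  have h := Algebra.norm_eq_prod_embeddings K ℂ x
  rw [RingHom.algebraMap_toAlgebra] at h
  rw [h, norm_prod, Real.log_prod fun σ _ => by simpa using hx]
  refine (Finset.sum_bij (fun (σ : L →ₐ[K] ℂ) _ => (σ : L →+* ℂ)) ?_ ?_ ?_ ?_).symm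
  · intro σ _
    simp only [Finset.mem_filter, Finset.mem_univ, true_and]
    exact σ.comp_algebraMap
  · intro σ _ τ _ hστ
    exact AlgHom.coe_ringHom_injective hστ
  · intro σ hσ
    simp only [Finset.mem_filter, Finset.mem_univ, true_and] at hσ
    exact ⟨{ σ with commutes' := fun a => RingHom.congr_fun hσ a }, Finset.mem_univ _, rfl⟩
  · intro σ _
    rfl

open scoped Classical in
theorem sum_embeddings_eq_sum_mult {F : Type*} [Field F] [NumberField F]
    (s : Finset (InfinitePlace F)) (f : InfinitePlace F → ℝ) :
    ∑ σ : F →+* ℂ with InfinitePlace.mk σ ∈ s, f (InfinitePlace.mk σ) =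
      ∑ w ∈ s, (w.mult : ℝ) * f w := by
  rw [← Finset.sum_fiberwise_of_maps_to (t := s) (g := InfinitePlace.mk) (by simp)]
  refine Finset.sum_congr rfl fun w hw => ?_
  rw [Finset.sum_congr rfl (g := fun _ => f w)
    (fun σ hσ => by rw [(Finset.mem_filter.mp hσ).2]), Finset.sum_const, nsmul_eq_mul,
    ← InfinitePlace.card_filter_mk_eq w, Finset.filter_filter]
  congr 3
  ext σ
  simp only [Finset.mem_filter, Finset.mem_univ, true_and, and_iff_right_iff_imp]
  rintro rfl
  exact hw

/-- Compatibility of the relative norm with the archimedean absolute values. -/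
theorem sum_placesAbove_mult_mul_log (K L : Type*) [Field K] [NumberField K] [Field L]
    [NumberField L] [Algebra K L] (v : InfinitePlace K) {x : L} (hx : x ≠ 0) :
    ∑ w ∈ placesAbove K L v, (w.mult : ℝ) * Real.log (w x) =
      v.mult * Real.log (v (Algebra.norm K x)) := by
  classical
  rw [← sum_embeddings_eq_sum_mult, ← Finset.sum_singleton
    (fun v : InfinitePlace K => (v.mult : ℝ) * Real.log (v (Algebra.norm K x))) v,
    ← sum_embeddings_eq_sum_mult,
    ← Finset.sum_fiberwise_of_maps_to (g := fun σ : L →+* ℂ => σ.comp (algebraMap K L))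
      (t := Finset.univ.filter fun φ : K →+* ℂ => InfinitePlace.mk φ ∈ ({v} : Finset _))]
  · refine Finset.sum_congr rfl fun φ hφ => ?_
    simp only [Finset.mem_filter, Finset.mem_univ, true_and, Finset.mem_singleton] at hφ
    simp only [InfinitePlace.apply]
    rw [← sum_log_norm_embeddings_over K L φ hx, Finset.filter_filter]
    refine Finset.sum_congr ?_ fun _ _ => rfl
    ext σ
    simp only [placesAbove, Finset.mem_filter, Finset.mem_univ, true_and,
      and_iff_right_iff_imp, InfinitePlace.comap_mk]
    rintro rfl
    exact hφ
  · intro σ hσ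
    simpa [placesAbove, InfinitePlace.comap_mk] using hσ

theorem LinearIndependent.real_of_int_of_discrete {E ι : Type*} [NormedAddCommGroup E]
    [NormedSpace ℝ E] [FiniteDimensional ℝ E] [Fintype ι] {v : ι → E}
    (hdisc : DiscreteTopology (Submodule.span ℤ (Set.range v)))
    (hv : LinearIndependent ℤ v) : LinearIndependent ℝ v := by
  rw [linearIndependent_iff_card_eq_finrank_span] at hv ⊢
  rw [hv, Real.finrank_eq_int_finrank_of_discrete hdisc]

section LogVector

variable {F : Type*} [Field F] [NumberField F]

theorem infLogAbs_prod_zpow {ι : Type*} [Fintype ι] (w : InfinitePlace F) {ε : ι → F}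
    (hε : ∀ j, ε j ≠ 0) (m : ι → ℤ) :
    infLogAbs F w (∏ j, ε j ^ m j) = ∑ j, (m j : ℝ) * infLogAbs F w (ε j) := by
  simp only [infLogAbs]
  rw [map_prod, Real.log_prod fun j _ => by
    rw [map_ne_zero]
    exact zpow_ne_zero _ (hε j), Finset.mul_sum]
  refine Finset.sum_congr rfl fun j _ => ?_
  rw [map_zpow₀, Real.log_zpow]
  ring

theorem sum_infLogAbs_units (u : (𝓞 F)ˣ) : ∑ w, infLogAbs F w (u : F) = 0 := by
  have h := Units.sum_mult_mul_log u
  simp only [infLogAbs, div_mul_eq_mul_div, ← Finset.sum_div, h, zero_div]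

theorem sum_abs_infLogAbs_units_le (u : (𝓞 F)ˣ) :
    ∑ w, |infLogAbs F w (u : F)| ≤ 2 * weilHeight F (u : F) := by
  have hfin : 0 ≤ ∑ᶠ v : IsDedekindDomain.HeightOneSpectrum (𝓞 F),
      max 0 (finLogAbs F v (u : F)) := finsum_nonneg fun _ => le_max_left _ _
  have habs (x : ℝ) : |x| = 2 * max 0 x - x := by
    rcases le_total 0 x with h | h
    · rw [abs_of_nonneg h, max_eq_right h]; ring
    · rw [abs_of_nonpos h, max_eq_left h]; ring
  simp only [habs, Finset.sum_sub_distrib, ← Finset.mul_sum, sum_infLogAbs_units, weilHeight]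
  linarith

open NumberField.Units NumberField.Units.dirichletUnitTheorem in
theorem linearIndependent_int_logEmbedding {r : ℕ} {u : Fin r → (𝓞 F)ˣ}
    (hu : MulIndep fun j => ((u j : 𝓞 F) : F)) :
    LinearIndependent ℤ fun j => logEmbedding F (Additive.ofMul (u j)) := by
  rw [Fintype.linearIndependent_iff]
  intro m hm
  have ht : ∏ j, u j ^ m j ∈ torsion F := by
    rw [← logEmbedding_eq_zero_iff, ← hm]
    simp [ofMul_prod, ofMul_zpow]
  obtain ⟨n, hn, hpow⟩ : ∃ n, 0 < n ∧ (∏ j, u j ^ m j) ^ n = 1 :=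
    isOfFinOrder_iff_pow_eq_one.mp ((CommGroup.mem_torsion _).mp ht)
  have hprod : (∏ j, ((u j : 𝓞 F) : F) ^ (m j * n)) = 1 := by
    let f : (𝓞 F)ˣ →* F := (algebraMap (𝓞 F) F : 𝓞 F →* F).comp (Units.coeHom _)
    have hf (x : (𝓞 F)ˣ) (k : ℤ) : f (x ^ k) = (x : F) ^ k := Units.coe_zpow x k
    have := congrArg f hpow
    rw [map_pow, map_prod, map_one, ← Finset.prod_pow] at this
    simpa only [zpow_mul, zpow_natCast, hf] using this
  intro j
  simpa [hn.ne'] using congrFun (hu _ hprod) j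

open NumberField.Units NumberField.Units.dirichletUnitTheorem in
theorem discreteTopology_span_logEmbedding {ι : Type*} (u : ι → (𝓞 F)ˣ) :
    DiscreteTopology
      (Submodule.span ℤ (Set.range fun j => logEmbedding F (Additive.ofMul (u j)))) := by
  have hle : Submodule.span ℤ (Set.range fun j => logEmbedding F (Additive.ofMul (u j))) ≤
      unitLattice F := by
    refine Submodule.span_le.mpr ?_
    rintro _ ⟨j, rfl⟩
    exact ⟨_, trivial, rfl⟩
  have hdisc : DiscreteTopology (unitLattice F) := inferInstance
  exact (hdisc.isDiscrete.mono hle).to_subtype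

open NumberField.Units NumberField.Units.dirichletUnitTheorem in
theorem linearIndependent_logEmbedding {r : ℕ} {u : Fin r → (𝓞 F)ˣ}
    (hu : MulIndep fun j => ((u j : 𝓞 F) : F)) :
    LinearIndependent ℝ fun j => logEmbedding F (Additive.ofMul (u j)) := by
  classical
  exact .real_of_int_of_discrete (discreteTopology_span_logEmbedding u)
    (linearIndependent_int_logEmbedding hu)

theorem linearIndependent_infLogAbs {r : ℕ} {u : Fin r → (𝓞 F)ˣ}
    (hu : MulIndep fun j => ((u j : 𝓞 F) : F)) :
    LinearIndependent ℝ fun j w => infLogAbs F w (u j : F) := by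
  let T : (InfinitePlace F → ℝ) →ₗ[ℝ] Units.dirichletUnitTheorem.logSpace F :=
    (finrank ℚ F : ℝ) • LinearMap.funLeft ℝ ℝ Subtype.val
  refine LinearIndependent.of_comp T ?_
  convert linearIndependent_logEmbedding hu using 1
  ext j w
  have : (finrank ℚ F : ℝ) ≠ 0 := by exact_mod_cast finrank_pos.ne'
  simp only [T, Function.comp_apply, LinearMap.smul_apply, Pi.smul_apply,
    LinearMap.funLeft_apply, smul_eq_mul, infLogAbs,
    Units.dirichletUnitTheorem.logEmbedding_component]
  field_simp

end LogVector

/-- Summation of a vector indexed by the infinite places of `L` over the fibres above the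
infinite places of `K`. -/
noncomputable def placesAboveSum (K L : Type*) [Field K] [Field L] [NumberField L]
    [Algebra K L] : (InfinitePlace L → ℝ) →ₗ[ℝ] (InfinitePlace K → ℝ) where
  toFun z v := ∑ w ∈ placesAbove K L v, z w
  map_add' x y := by ext v; simp [Finset.sum_add_distrib]
  map_smul' c x := by ext v; simp [Finset.mul_sum]

theorem placesAboveSum_surjective (K L : Type*) [Field K] [NumberField K] [Field L]
    [NumberField L] [Algebra K L] : Function.Surjective (placesAboveSum K L) := by
  classical
  intro y
  choose s hs using InfinitePlace.comap_surjective (k := K) (K := L)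
  refine ⟨fun w => if s (w.comap (algebraMap K L)) = w then y (w.comap (algebraMap K L)) else 0, ?_⟩
  ext v
  change ∑ w ∈ placesAbove K L v, _ = _
  rw [Finset.sum_eq_single (s v)]
  · simp [show (s v).comap (algebraMap K L) = v from hs v]
  · intro w hw hne
    have : w.comap (algebraMap K L) = v := (Finset.mem_filter.mp hw).2
    rw [this, if_neg hne.symm]
  · intro h
    exact absurd (by simpa [placesAbove] using hs v) h

theorem finrank_ker_placesAboveSum (K L : Type*) [Field K] [NumberField K] [Field L]
    [NumberField L] [Algebra K L] :
    finrank ℝ (LinearMap.ker (placesAboveSum K L)) = Units.rank L - Units.rank K := by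
  have h := (placesAboveSum K L).finrank_range_add_finrank_ker
  rw [LinearMap.range_eq_top.mpr (placesAboveSum_surjective K L), finrank_top,
    finrank_fintype_fun_eq_card, finrank_fintype_fun_eq_card] at h
  have hK : 0 < Fintype.card (InfinitePlace K) := Fintype.card_pos
  simp only [Units.rank]
  omega

/-- Rounding the coordinates of `z` with respect to the vectors `l j`. -/
theorem exists_int_sum_abs_sub_le {ι W : Type*} [Fintype ι] [Fintype W] (l : ι → W → ℝ)
    {z : W → ℝ} (hz : z ∈ Submodule.span ℝ (Set.range l)) :
    ∃ m : ι → ℤ, ∑ w, |∑ j, (m j : ℝ) * l j w - z w| ≤ ∑ j, 1 / 2 * ∑ w, |l j w| := by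
  obtain ⟨c, rfl⟩ := (Submodule.mem_span_range_iff_exists_fun ℝ).mp hz
  refine ⟨fun j => round (c j), ?_⟩
  simp_rw [Finset.mul_sum]
  rw [Finset.sum_comm]
  refine Finset.sum_le_sum fun w _ => ?_
  rw [Finset.sum_apply, ← Finset.sum_sub_distrib]
  refine (Finset.abs_sum_le_sum_abs _ _).trans (Finset.sum_le_sum fun j _ => ?_)
  rw [Pi.smul_apply, smul_eq_mul, ← sub_mul, abs_mul, abs_sub_comm]
  exact mul_le_mul_of_nonneg_right (abs_sub_round _) (abs_nonneg _)

/-- **Lemma 3.1.** Let `ε₁, …, ε_{r(l/k)}` (with `r(l/k) = r(l) − r(k)`) be multiplicatively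
independent relative units in `E_{l/k}(𝔐)`, generating the subgroup `𝔈`.  If `z = (z_w)` is a
real vector indexed by the archimedean places of `l` with `∑_{w∣v} z_w = 0` for every
archimedean place `v` of `k`, then there is `γ ∈ 𝔈` with
`∑_{w∣∞} |log|γ|_w − z_w| ≤ ∑ⱼ h(εⱼ)`. -/
theorem exists_relUnit_close_to_vector
    (K L : Type*) [Field K] [NumberField K] [Field L] [NumberField L] [Algebra K L]
    (e : ℕ) (he : e = finrank K L) (b : Basis (Fin e) K L)
    (hbInt : ∀ i, IsIntegral ℤ (b i))
    (M : Set L) (hM : M = fullModule K (fun i => b i))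
    (ε : Fin (Units.rank L - Units.rank K) → L)
    (hε : ∀ j, ε j ∈ relUnits K L M) (hind : MulIndep ε)
    (z : InfinitePlace L → ℝ)
    (hz : ∀ v : InfinitePlace K, ∑ w ∈ placesAbove K L v, z w = 0) :
    ∃ γ : L, (∃ m : Fin (Units.rank L - Units.rank K) → ℤ, γ = ∏ j, ε j ^ m j) ∧
      ∑ w : InfinitePlace L, |infLogAbs L w γ - z w| ≤
        ∑ j, weilHeight L (ε j) := by
  choose u hu using fun j => (hε j).1.2
  obtain rfl : (fun j => ((u j : 𝓞 L) : L)) = ε := funext hu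
  have h0 (j) : ((u j : 𝓞 L) : L) ≠ 0 := by simp
  have hker (j) : (fun w => infLogAbs L w (u j : L)) ∈ LinearMap.ker (placesAboveSum K L) := by
    obtain ⟨n, hn, hnorm⟩ := (hε j).2
    rw [LinearMap.mem_ker]
    ext v
    change ∑ w ∈ placesAbove K L v, infLogAbs L w (u j : L) = 0
    have hv : v (Algebra.norm K (u j : L)) = 1 := by
      refine (pow_eq_one_iff_of_nonneg (apply_nonneg _ _) hn.ne').mp ?_
      rw [← map_pow, hnorm, map_one]
    simp only [infLogAbs, div_mul_eq_mul_div, ← Finset.sum_div,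
      sum_placesAbove_mult_mul_log K L v (h0 j), hv, Real.log_one, mul_zero, zero_div]
  have hspan : Submodule.span ℝ (Set.range fun j w => infLogAbs L w (u j : L)) =
      LinearMap.ker (placesAboveSum K L) := by
    refine Submodule.eq_of_le_of_finrank_eq (Submodule.span_le.mpr ?_) ?_
    · rintro _ ⟨j, rfl⟩
      exact hker j
    · rw [finrank_span_eq_card (linearIndependent_infLogAbs hind), Fintype.card_fin,
        finrank_ker_placesAboveSum]
  obtain ⟨m, hm⟩ := exists_int_sum_abs_sub_le (z := z) _
    (hspan ▸ LinearMap.mem_ker.mpr (funext hz) :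
      z ∈ Submodule.span ℝ (Set.range fun j w => infLogAbs L w (u j : L)))
  refine ⟨_, ⟨m, rfl⟩, ?_⟩
  simp only [infLogAbs_prod_zpow _ h0]
  refine hm.trans (Finset.sum_le_sum fun j _ => ?_)
  linarith [sum_abs_infLogAbs_units_le (u j)]
end
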